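/- arXiv:2604.13356 — 2 statements merged into one kernel-verified Lean document; each statement's English description precedes it below -/
import Mathlib

section
/- The limit v* := lim_{t→∞} v(t) exists as a real number, and it satisfies v(0) ≤ v* ≤ 1. -/
open Filter Topology

theorem aux_nonneg (u c : ℝ → ℝ) (hc : ContinuousOn c (Set.Ici 0))
    (hu : ∀ t ≥ (0:ℝ), HasDerivAt u (-(c t * u t)) t) (h0 : 0 ≤ u 0) :
    ∀ t ≥ (0:ℝ), 0 ≤ u t := by
  have hcc : Continuous (fun t => c (max t 0)) :=
    hc.comp_continuous (by fun_prop) (fun t => le_max_right t 0)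
  have hC : ∀ t, HasDerivAt (fun t => ∫ x in (0:ℝ)..t, c (max x 0)) (c (max t 0)) t :=
    fun t => hcc.integral_hasStrictDerivAt 0 t |>.hasDerivAt
  intro t ht
  have hd : ∀ x ≥ (0:ℝ), HasDerivAt
      (fun t => u t * Real.exp (∫ x in (0:ℝ)..t, c (max x 0))) 0 x := by
    intro x hx
    have h := (hu x hx).mul (hC x).exp
    refine HasDerivAt.congr_deriv h ?_
    rw [max_eq_left hx]
    ring
  have key := constant_of_has_deriv_right_zero
    (f := fun t => u t * Real.exp (∫ x in (0:ℝ)..t, c (max x 0))) (a := 0) (b := t)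
    (fun x hx => (hd x hx.1).continuousAt.continuousWithinAt)
    (fun x hx => (hd x hx.1).hasDerivWithinAt) t ⟨ht, le_refl t⟩
  simp at key
  have hp := Real.exp_pos (∫ x in (0:ℝ)..t, c (max x 0))
  by_contra hneg
  push Not at hneg
  nlinarith [mul_neg_of_neg_of_pos hneg hp]

theorem aux_mono (f f' : ℝ → ℝ) (hf : ∀ t ≥ (0:ℝ), HasDerivAt f (f' t) t)
    (h : ∀ t ≥ (0:ℝ), 0 ≤ f' t) : MonotoneOn f (Set.Ici 0) := by
  apply monotoneOn_of_deriv_nonneg (convex_Ici 0)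
  · exact fun x hx => (hf x hx).continuousAt.continuousWithinAt
  · intro x hx
    exact (hf x (interior_subset hx)).differentiableAt.differentiableWithinAt
  · intro x hx
    rw [(hf x (interior_subset hx)).deriv]
    exact h x (interior_subset hx)

theorem stmt_5
    (n : ℕ) (hn : 1 ≤ n) (α β : ℝ) (hα : 0 < α) (hβ : 0 < β)
    (s : Fin n → ℝ → ℝ) (v : ℝ → ℝ)
    (hs : ∀ i, ∀ t ≥ (0:ℝ),
      HasDerivAt (s i) (α * (1 - s i t) * max (v t - s i t) 0) t)
    (hv : ∀ t ≥ (0:ℝ),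
      HasDerivAt v (β * (1 - v t) * ⨆ i, s i t) t)
    (hs0 : ∀ i, s i 0 ∈ Set.Icc (0:ℝ) 1)
    (hv0 : v 0 ∈ Set.Icc (0:ℝ) 1)
    : ∃ vStar : ℝ, Tendsto v atTop (𝓝 vStar) ∧ v 0 ≤ vStar ∧ vStar ≤ 1 := by
  have hsc : ∀ i, ContinuousOn (s i) (Set.Ici 0) :=
    fun i x hx => (hs i x hx).continuousAt.continuousWithinAt
  have hvc : ContinuousOn v (Set.Ici 0) :=
    fun x hx => (hv x hx).continuousAt.continuousWithinAt
  have hs1 : ∀ i, ∀ t ≥ (0:ℝ), 0 ≤ 1 - s i t := by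
    intro i
    apply aux_nonneg (fun t => 1 - s i t) (fun t => α * max (v t - s i t) 0)
    · exact continuousOn_const.mul ((hvc.sub (hsc i)).sup continuousOn_const)
    · intro t ht
      refine ((hs i t ht).const_sub 1).congr_deriv ?_
      ring
    · linarith [(hs0 i).2]
  have hsn : ∀ i, ∀ t ≥ (0:ℝ), 0 ≤ s i t := by
    intro i t ht
    have := aux_mono (s i) _ (hs i) (fun t ht =>
      mul_nonneg (mul_nonneg hα.le (hs1 i t ht)) (le_max_right _ _))
      (Set.mem_Ici.2 le_rfl) (Set.mem_Ici.2 ht) ht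
    linarith [(hs0 i).1]
  have hMc : ContinuousOn (fun t => ⨆ i, s i t) (Set.Ici 0) := by
    haveI : Nonempty (Fin n) := ⟨⟨0, hn⟩⟩
    simp_rw [← Finset.sup'_univ_eq_ciSup]
    exact ContinuousOn.finset_sup'_apply _ (fun i _ => hsc i)
  have hv1 : ∀ t ≥ (0:ℝ), 0 ≤ 1 - v t := by
    apply aux_nonneg (fun t => 1 - v t) (fun t => β * ⨆ i, s i t)
    · exact continuousOn_const.mul hMc
    · intro t ht
      refine ((hv t ht).const_sub 1).congr_deriv ?_
      ring
    · linarith [hv0.2]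
  have hm := aux_mono v _ hv (fun t ht =>
    mul_nonneg (mul_nonneg hβ.le (hv1 t ht)) (Real.iSup_nonneg (fun i => hsn i t ht)))
  have hm' : Monotone (fun t => v (max t 0)) := fun a b hab =>
    hm (le_max_right a 0) (le_max_right b 0) (max_le_max_right 0 hab)
  have hb : ∀ t, v (max t 0) ≤ 1 := fun t => by linarith [hv1 (max t 0) (le_max_right t 0)]
  have hbd : BddAbove (Set.range (fun t => v (max t 0))) := ⟨1, by rintro _ ⟨t, rfl⟩; exact hb t⟩
  refine ⟨⨆ t, v (max t 0), (tendsto_atTop_ciSup hm' hbd).congr' ?_, ?_, ciSup_le hb⟩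
  · filter_upwards [eventually_ge_atTop 0] with t ht
    rw [max_eq_left ht]
  · simpa using le_ciSup hbd 0
end

section
/- (Full convergence theorem for PST dynamics.) The following all hold: (1) for every index i, s_i(t) is monotone non-decreasing in t and the limit s_i* := lim_{t→∞} s_i(t) exists with s_i* ≥ s_i(0); (2) v(t) is monotone non-decreasing in t and the limit v* := lim_{t→∞} v(t) exists with v* ≥ v(0); (3) for every index i with s_i(0) < v*, one has s_i* = v*. -/
open Filter Topology

theorem barrier_aux (f f' : ℝ → ℝ) (c : ℝ) (hf : ∀ t ≥ (0:ℝ), HasDerivAt f (f' t) t)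
    (h0 : f 0 ≤ c) (hc : ∀ t ≥ (0:ℝ), c < f t → f' t ≤ 0) : ∀ t ≥ (0:ℝ), f t ≤ c := by
  intro T hT
  have key : ∀ ε > (0:ℝ), f T ≤ c + ε * (1 + T) := by
    intro ε hε
    have := image_le_of_deriv_right_lt_deriv_boundary (f := f) (f' := f') (a := 0) (b := T)
      (B := fun t => c + ε * (1 + t)) (B' := fun _ => ε)
      (fun t ht => (hf t ht.1).continuousAt.continuousWithinAt)
      (fun t ht => (hf t ht.1).hasDerivWithinAt)
      (by linarith)
      (fun t => by
        simpa using (((hasDerivAt_id t).const_add 1).const_mul ε).const_add c)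
      (fun t ht h => by
        have h1 : c < f t := by
          rw [h]; have := ht.1
          have : 0 < ε * (1 + t) := by positivity
          linarith
        exact lt_of_le_of_lt (hc t ht.1 h1) hε)
    exact this ⟨hT, le_rfl⟩
  by_contra h
  push Not at h
  have h1 : 0 < 1 + T := by linarith
  have := key ((f T - c) / (2 * (1 + T))) (div_pos (by linarith) (by linarith))
  have e : (f T - c) / (2 * (1 + T)) * (1 + T) = (f T - c) / 2 := by field_simp
  rw [e] at this
  linarith

theorem mono_aux (f f' : ℝ → ℝ) (a : ℝ) (hf : ∀ t ≥ a, HasDerivAt f (f' t) t)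
    (hc : ∀ t ≥ a, 0 ≤ f' t) : ∀ t₁ t₂ : ℝ, a ≤ t₁ → t₁ ≤ t₂ → f t₁ ≤ f t₂ := by
  intro t₁ t₂ h1 h2
  have : MonotoneOn f (Set.Ici a) := by
    apply monotoneOn_of_deriv_nonneg (convex_Ici a)
    · exact fun t ht => (hf t ht).continuousAt.continuousWithinAt
    · intro t ht
      rw [interior_Ici] at ht
      exact (hf t (le_of_lt ht)).differentiableAt.differentiableWithinAt
    · intro t ht
      rw [interior_Ici] at ht
      rw [(hf t (le_of_lt ht)).deriv]
      exact hc t (le_of_lt ht)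
  exact this h1 (h1.trans h2) h2

theorem lim_aux (f : ℝ → ℝ) (C : ℝ) (hm : ∀ t₁ t₂ : ℝ, 0 ≤ t₁ → t₁ ≤ t₂ → f t₁ ≤ f t₂)
    (hC : ∀ t ≥ (0:ℝ), f t ≤ C) : ∃ l, Tendsto f atTop (𝓝 l) := by
  have hg : Monotone (fun t => f (max t 0)) := fun a b hab =>
    hm _ _ (le_max_right _ _) (max_le_max_right 0 hab)
  have hb : BddAbove (Set.range (fun t => f (max t 0))) :=
    ⟨C, by rintro _ ⟨t, rfl⟩; exact hC _ (le_max_right _ _)⟩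
  refine ⟨_, (tendsto_atTop_ciSup hg hb).congr' ?_⟩
  filter_upwards [eventually_ge_atTop 0] with t ht
  simp [max_eq_left ht]

theorem le_lim_aux (f : ℝ → ℝ) (l : ℝ) (hm : ∀ t₁ t₂ : ℝ, 0 ≤ t₁ → t₁ ≤ t₂ → f t₁ ≤ f t₂)
    (h : Tendsto f atTop (𝓝 l)) : ∀ t ≥ (0:ℝ), f t ≤ l := by
  intro t ht
  refine ge_of_tendsto h ?_
  filter_upwards [eventually_ge_atTop t] with u hu
  exact hm t u ht hu

theorem stmt_11
    (n : ℕ) (hn : 1 ≤ n) (α β : ℝ) (hα : 0 < α) (hβ : 0 < β)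
    (s : Fin n → ℝ → ℝ) (v : ℝ → ℝ)
    (hs : ∀ i, ∀ t ≥ (0:ℝ),
      HasDerivAt (s i) (α * (1 - s i t) * max (v t - s i t) 0) t)
    (hv : ∀ t ≥ (0:ℝ),
      HasDerivAt v (β * (1 - v t) * ⨆ i, s i t) t)
    (hs0 : ∀ i, s i 0 ∈ Set.Icc (0:ℝ) 1)
    (hv0 : v 0 ∈ Set.Icc (0:ℝ) 1)
    : (∀ i, (∀ t₁ t₂ : ℝ, 0 ≤ t₁ → t₁ ≤ t₂ → s i t₁ ≤ s i t₂) ∧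
        ∃ sStar : ℝ, Tendsto (s i) atTop (𝓝 sStar) ∧ s i 0 ≤ sStar) ∧
      (∀ t₁ t₂ : ℝ, 0 ≤ t₁ → t₁ ≤ t₂ → v t₁ ≤ v t₂) ∧
      ∃ vStar : ℝ, Tendsto v atTop (𝓝 vStar) ∧ v 0 ≤ vStar ∧
        ∀ i, ∀ sStar : ℝ, Tendsto (s i) atTop (𝓝 sStar) →
          s i 0 < vStar → sStar = vStar := by
  have s1 : ∀ i, ∀ t ≥ (0:ℝ), s i t ≤ 1 := fun i =>
    barrier_aux _ _ 1 (hs i) (hs0 i).2 fun t _ h =>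
      mul_nonpos_of_nonpos_of_nonneg (mul_nonpos_of_nonneg_of_nonpos hα.le (by linarith))
        (le_max_right _ _)
  have sm : ∀ i, ∀ t₁ t₂ : ℝ, 0 ≤ t₁ → t₁ ≤ t₂ → s i t₁ ≤ s i t₂ := fun i =>
    mono_aux _ _ 0 (hs i) fun t ht =>
      mul_nonneg (mul_nonneg hα.le (by linarith [s1 i t ht])) (le_max_right _ _)
  have M0 : ∀ t ≥ (0:ℝ), 0 ≤ ⨆ i, s i t := fun t ht =>
    Real.iSup_nonneg fun i => (hs0 i).1.trans (sm i 0 t le_rfl ht)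
  have v1 : ∀ t ≥ (0:ℝ), v t ≤ 1 :=
    barrier_aux _ _ 1 hv hv0.2 fun t ht h =>
      mul_nonpos_of_nonpos_of_nonneg (mul_nonpos_of_nonneg_of_nonpos hβ.le (by linarith))
        (M0 t ht)
  have vm : ∀ t₁ t₂ : ℝ, 0 ≤ t₁ → t₁ ≤ t₂ → v t₁ ≤ v t₂ :=
    mono_aux _ _ 0 hv fun t ht =>
      mul_nonneg (mul_nonneg hβ.le (by linarith [v1 t ht])) (M0 t ht)
  refine ⟨fun i => ⟨sm i, ?_⟩, vm, ?_⟩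
  · obtain ⟨l, hl⟩ := lim_aux _ 1 (sm i) (s1 i)
    exact ⟨l, hl, le_lim_aux _ _ (sm i) hl 0 le_rfl⟩
  obtain ⟨V, hV⟩ := lim_aux _ 1 vm v1
  have vV := le_lim_aux _ _ vm hV
  refine ⟨V, hV, vV 0 le_rfl, ?_⟩
  intro i S hS h0
  have V1 : V ≤ 1 := le_of_tendsto hV (by
    filter_upwards [eventually_ge_atTop 0] with t ht using v1 t ht)
  have sV : ∀ t ≥ (0:ℝ), s i t ≤ V :=
    barrier_aux _ _ V (hs i) h0.le fun t ht h => by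
      rw [max_eq_right (by linarith [vV t ht])]; simp
  have SV : S ≤ V := le_of_tendsto hS (by
    filter_upwards [eventually_ge_atTop 0] with t ht using sV t ht)
  have sS := le_lim_aux _ _ (sm i) hS
  by_contra hne
  have hlt : S < V := lt_of_le_of_ne SV hne
  have hev : ∀ᶠ t in atTop, (S + V) / 2 < v t := hV.eventually (lt_mem_nhds (by linarith))
  obtain ⟨T, hT0, hT⟩ : ∃ T ≥ (0:ℝ), (S + V) / 2 < v T :=
    ((eventually_ge_atTop 0).and hev).exists
  set c := α * (1 - S) * ((V - S) / 2) with hc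
  have cpos : 0 < c := by
    have : 0 < 1 - S := by linarith
    have : 0 < V - S := by linarith
    positivity
  have hm := mono_aux (fun t => s i t - c * t)
    (fun t => α * (1 - s i t) * max (v t - s i t) 0 - c) T
    (fun t ht => by
      have h := (hs i t (hT0.le.trans ht)).sub ((hasDerivAt_id t).const_mul c)
      rw [mul_one] at h
      exact h)
    (fun t ht => by
      have t0 : 0 ≤ t := hT0.le.trans ht
      have a1 := sS t t0
      have a2 := vm T t hT0 ht
      have : c ≤ α * (1 - s i t) * max (v t - s i t) 0 := by
        rw [hc]
        refine mul_le_mul (mul_le_mul_of_nonneg_left (by linarith) hα.le)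
          (le_max_of_le_left (by linarith)) (by linarith)
          (mul_nonneg hα.le (by linarith))
      linarith)
  have h2 := hm T (T + 2 / c) le_rfl (by have : 0 < 2 / c := by positivity
                                         linarith)
  have h3 := s1 i (T + 2 / c) (by positivity)
  have h4 := (hs0 i).1.trans (sm i 0 T le_rfl hT0)
  have h5 : c * (T + 2 / c) = c * T + 2 := by field_simp
  simp only [h5] at h2
  linarith
end
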